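/- arXiv:2009.09522 — 2 statements merged into one kernel-verified Lean document; each statement's English description precedes it below -/
import Mathlib

section
/- Let x₁,…,xₙ be points in a metric space satisfying the CAT(0) comparison, with associated quadratic form W on ℝ^{n−1} (vertices v₁,…,v_{n−1} the standard basis, vₙ = 0). Let L ⊆ ℝ^{n−1} be a linear subspace with W(v) < 0 for every nonzero v ∈ L, and let π be a linear map with kernel L. If for some four distinct indices i₁, i₂, i₃, i₄ the projections π(v_{i₁}), π(v_{i₂}), π(v_{i₃}), π(v_{i₄}) lie in a common affine plane, then one of these four projected points lies in the convex hull of the other three. -/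
/-- The quadruple `(p,q,x,y)` satisfies the CAT(0) (2+2) comparison with respect to the
distance function `d`. -/
def Cat0Quad {X : Type*} (d : X → X → ℝ) (p q x y : X) : Prop :=
  ∃ p' q' x' y' : EuclideanSpace ℝ (Fin 2),
    dist x' y' = d x y ∧
    dist p' x' = d p x ∧ dist p' y' = d p y ∧
    dist q' x' = d q x ∧ dist q' y' = d q y ∧
    ((y' 0 - x' 0) * (p' 1 - x' 1) - (y' 1 - x' 1) * (p' 0 - x' 0)) *
      ((y' 0 - x' 0) * (q' 1 - x' 1) - (y' 1 - x' 1) * (q' 0 - x' 0)) ≤ 0 ∧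
    ∀ z ∈ segment ℝ x' y', d p q ≤ dist p' z + dist z q'

/-- A metric space satisfies the CAT(0) comparison if every quadruple of its points,
in every labeling, satisfies the CAT(0) (2+2) comparison. -/
def Cat0Comparison (X : Type*) [MetricSpace X] : Prop :=
  ∀ p q x y : X, Cat0Quad (fun a b => dist a b) p q x y

/-- The vertices of the standard simplex in `ℝⁿ`: `stdVert n i` for `i < n` is the `i`-th
standard basis vector, and `stdVert n n = 0`. -/
noncomputable def stdVert (n : ℕ) (i : Fin (n + 1)) : EuclideanSpace ℝ (Fin n) :=
  if h : (i : ℕ) < n then EuclideanSpace.single ⟨i, h⟩ 1 else 0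

theorem QuadraticMap.map_affine_combination {E : Type*} [AddCommGroup E] [Module ℝ E]
    (W : QuadraticForm ℝ E) (a b : E) (s : ℝ) :
    W (s • a + (1 - s) • b) = s * W a + (1 - s) * W b - s * (1 - s) * W (a - b) := by
  have h₁ := QuadraticMap.map_add W (s • a) ((1 - s) • b)
  have h₂ := QuadraticMap.map_add W a (-b)
  rw [QuadraticMap.polar_smul_left, QuadraticMap.polar_smul_right, QuadraticMap.map_smul,
    QuadraticMap.map_smul] at h₁
  rw [QuadraticMap.polar_neg_right, QuadraticMap.map_neg, ← sub_eq_add_neg] at h₂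
  simp only [smul_eq_mul] at h₁
  rw [h₁, h₂]
  ring

theorem QuadraticMap.map_segment_sub_segment {E : Type*} [AddCommGroup E] [Module ℝ E]
    (W : QuadraticForm ℝ E) (p q x y : E) (s t : ℝ) :
    W (s • p + (1 - s) • q - (t • x + (1 - t) • y)) =
      s * (t * W (p - x) + (1 - t) * W (p - y) - t * (1 - t) * W (x - y)) +
      (1 - s) * (t * W (q - x) + (1 - t) * W (q - y) - t * (1 - t) * W (x - y)) -
      s * (1 - s) * W (p - q) := by
  have key (r : E) : W (r - (t • x + (1 - t) • y)) =
      t * W (r - x) + (1 - t) * W (r - y) - t * (1 - t) * W (x - y) := by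
    have h := QuadraticMap.map_affine_combination W (r - x) (r - y) t
    rw [show r - x - (r - y) = -(x - y) by abel, QuadraticMap.map_neg] at h
    rw [← h]
    congr 1
    module
  have h := QuadraticMap.map_affine_combination W (p - (t • x + (1 - t) • y))
    (q - (t • x + (1 - t) • y)) s
  rw [sub_sub_sub_cancel_right, key, key] at h
  rw [← h]
  congr 1
  module

theorem EuclideanSpace.dist_sq_affine_combination {ι : Type*} [Fintype ι]
    (p x y : EuclideanSpace ℝ ι) (t : ℝ) :
    dist p (t • x + (1 - t) • y) ^ 2 =
      t * dist p x ^ 2 + (1 - t) * dist p y ^ 2 - t * (1 - t) * dist x y ^ 2 := by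
  simp only [EuclideanSpace.dist_sq_eq, Real.dist_eq, sq_abs, Finset.mul_sum,
    ← Finset.sum_add_distrib, ← Finset.sum_sub_distrib]
  refine Finset.sum_congr rfl fun i _ => ?_
  simp only [PiLp.add_apply, PiLp.smul_apply, smul_eq_mul]
  ring

theorem Cat0Quad.weighted_dist_sq_nonneg {X : Type*} [MetricSpace X] {p q x y : X}
    (h : Cat0Quad (fun a b => dist a b) p q x y) {s t : ℝ}
    (hs : s ∈ Set.Icc (0 : ℝ) 1) (ht : t ∈ Set.Icc (0 : ℝ) 1) :
    0 ≤ s * (t * dist p x ^ 2 + (1 - t) * dist p y ^ 2 - t * (1 - t) * dist x y ^ 2) +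
      (1 - s) * (t * dist q x ^ 2 + (1 - t) * dist q y ^ 2 - t * (1 - t) * dist x y ^ 2) -
      s * (1 - s) * dist p q ^ 2 := by
  obtain ⟨p', q', x', y', hxy, hpx, hpy, hqx, hqy, -, hseg⟩ := h
  have hz := hseg (t • x' + (1 - t) • y') ⟨t, 1 - t, ht.1, sub_nonneg.2 ht.2, by ring, rfl⟩
  rw [dist_comm _ q'] at hz
  simp only at hxy hpx hpy hqx hqy hz
  rw [← hxy, ← hpx, ← hpy, ← hqx, ← hqy, ← EuclideanSpace.dist_sq_affine_combination,
    ← EuclideanSpace.dist_sq_affine_combination]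
  set a := dist p' (t • x' + (1 - t) • y')
  set b := dist q' (t • x' + (1 - t) • y')
  have hsq : dist p q ^ 2 ≤ (a + b) ^ 2 := pow_le_pow_left₀ dist_nonneg hz 2
  have hss : 0 ≤ s * (1 - s) := mul_nonneg hs.1 (sub_nonneg.2 hs.2)
  nlinarith [mul_le_mul_of_nonneg_left hsq hss, sq_nonneg (s * a - (1 - s) * b)]

theorem stdVert_apply (n : ℕ) (i : Fin (n + 1)) (j : Fin n) :
    stdVert n i j = if i = j.castSucc then 1 else 0 := by
  unfold stdVert
  split_ifs with h₁ h₂ h₂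
  · subst h₂
    simp
  · rw [PiLp.single_apply, if_neg]
    rintro rfl
    exact h₂ rfl
  · subst h₂
    exact absurd j.isLt h₁
  · rfl

theorem stdVert_affineIndependent (n : ℕ) : AffineIndependent ℝ (stdVert n) := by
  rw [affineIndependent_iff_of_fintype]
  intro w hw hzero
  rw [Finset.univ.weightedVSub_eq_linear_combination hw] at hzero
  have hcast (j : Fin n) : w j.castSucc = 0 := by
    simpa [stdVert_apply] using congrArg (fun v : EuclideanSpace ℝ (Fin n) => v j) hzero
  refine Fin.lastCases ?_ hcast
  simpa [Fin.sum_univ_castSucc, hcast] using hw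

theorem mem_convexHull_image_of_sum_smul_eq_zero {ι F : Type*} [Fintype ι] [DecidableEq ι]
    [AddCommGroup F] [Module ℝ F] (f : ι → F) (w : ι → ℝ) (hw : ∑ i, w i = 0)
    (hf : ∑ i, w i • f i = 0) (a : ι) (ha : w a ≠ 0) (hb : ∀ b ≠ a, w a * w b ≤ 0) :
    f a ∈ convexHull ℝ (f '' {b | b ≠ a}) := by
  rw [← Finset.add_sum_erase _ _ (Finset.mem_univ a)] at hw hf
  have hmem := (convex_convexHull ℝ (f '' {b | b ≠ a})).sum_mem
    (t := Finset.univ.erase a) (w := fun b => -(w a)⁻¹ * w b) (z := f) ?_ ?_ ?_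
  · convert hmem using 1
    simp only [mul_smul, ← Finset.smul_sum]
    rw [← neg_eq_of_add_eq_zero_right hf, smul_neg, neg_smul, neg_neg, inv_smul_smul₀ ha]
  · intro b hba
    have h := hb b (Finset.ne_of_mem_erase hba)
    have : -(w a)⁻¹ * w b = -(w a * w b) / w a ^ 2 := by field_simp
    rw [this]
    exact div_nonneg (neg_nonneg.2 h) (sq_nonneg _)
  · rw [← Finset.mul_sum, ← neg_eq_of_add_eq_zero_right hw]
    field_simp
  · exact fun b hba => subset_convexHull ℝ _ ⟨b, Finset.ne_of_mem_erase hba, rfl⟩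

theorem Coplanar.exists_affine_dependence {F : Type*} [AddCommGroup F] [Module ℝ F]
    {f : Fin 4 → F} (h : Coplanar ℝ (Set.range f)) :
    ∃ w : Fin 4 → ℝ, ∑ i, w i = 0 ∧ ∑ i, w i • f i = 0 ∧ ∃ i, w i ≠ 0 := by
  by_contra! hcon
  have hind : AffineIndependent ℝ f := by
    rw [affineIndependent_iff_of_fintype]
    intro w hw hf
    rw [Finset.univ.weightedVSub_eq_linear_combination hw] at hf
    exact hcon w hw hf
  have h₂ := h.finrank_le_two
  rw [hind.finrank_vectorSpan (n := 3) (by simp)] at h₂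
  omega

theorem Cat0Comparison.quadraticForm_nonneg {X : Type*} [MetricSpace X]
    (hX : Cat0Comparison X) {ι E : Type*} [AddCommGroup E] [Module ℝ E] (x : ι → X) (v : ι → E)
    (W : QuadraticForm ℝ E) (hW : ∀ i j, W (v i - v j) = dist (x i) (x j) ^ 2)
    (w : ι → ℝ) {a b c d : ι} (ha : 0 < w a) (hb : 0 < w b) (hc : w c < 0) (hd : w d < 0)
    (hw : w a + (w b + (w c + w d)) = 0) :
    0 ≤ W (w a • v a + (w b • v b + (w c • v c + w d • v d))) := by
  have hS : 0 < w a + w b := add_pos ha hb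
  have hs : w a / (w a + w b) ∈ Set.Icc (0 : ℝ) 1 :=
    ⟨by positivity, (div_le_one hS).2 (by linarith)⟩
  have ht : -w c / (w a + w b) ∈ Set.Icc (0 : ℝ) 1 :=
    ⟨div_nonneg (by linarith) hS.le, (div_le_one hS).2 (by linarith)⟩
  have h := (hX (x a) (x b) (x c) (x d)).weighted_dist_sq_nonneg hs ht
  simp only [← hW] at h
  rw [← QuadraticMap.map_segment_sub_segment] at h
  have hcomb : w a • v a + (w b • v b + (w c • v c + w d • v d)) =
      (w a + w b) • ((w a / (w a + w b)) • v a + (1 - w a / (w a + w b)) • v b -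
        ((-w c / (w a + w b)) • v c + (1 - -w c / (w a + w b)) • v d)) := by
    have hd' : w d = -(w a + w b + w c) := by linarith
    rw [hd']
    match_scalars <;> field_simp <;> ring
  rw [hcomb, QuadraticMap.map_smul]
  exact mul_nonneg (mul_self_nonneg _) h

/-- Let `x₀, …, xₙ` be points in a metric space satisfying the CAT(0) comparison, with
associated quadratic form `W` on `ℝⁿ`.  Let `L` be a subspace on whose nonzero vectors
`W` is negative, and let `π` be a linear map with kernel `L`.  If the projections of four
distinct vertices of the standard simplex are coplanar, then one of these four projected
points lies in the convex hull of the other three. -/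
theorem coplanar_projection_has_point_inside {X : Type*} [MetricSpace X]
    (hX : Cat0Comparison X) (n : ℕ) (x : Fin (n + 1) → X)
    (W : QuadraticForm ℝ (EuclideanSpace ℝ (Fin n)))
    (hW : ∀ i j, W (stdVert n i - stdVert n j) = dist (x i) (x j) ^ 2)
    (L : Submodule ℝ (EuclideanSpace ℝ (Fin n)))
    (hL : ∀ v ∈ L, v ≠ 0 → W v < 0)
    {F : Type*} [AddCommGroup F] [Module ℝ F]
    (π : EuclideanSpace ℝ (Fin n) →ₗ[ℝ] F)
    (hπ : LinearMap.ker π = L)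
    (idx : Fin 4 → Fin (n + 1)) (hinj : Function.Injective idx)
    (hplane : Coplanar ℝ (Set.range fun a => π (stdVert n (idx a)))) :
    ∃ a : Fin 4, π (stdVert n (idx a)) ∈
      convexHull ℝ ((fun b => π (stdVert n (idx b))) '' {b | b ≠ a}) := by
  by_contra! hcon
  obtain ⟨w, hw, hf, i, hi⟩ := hplane.exists_affine_dependence
  have hside (a : Fin 4) (ha : w a ≠ 0) : ∃ b ≠ a, 0 < w a * w b := by
    by_contra! hb
    exact hcon a (mem_convexHull_image_of_sum_smul_eq_zero
      (fun b => π (stdVert n (idx b))) w hw hf a ha hb)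
  obtain ⟨a, -, ha⟩ := Finset.exists_pos_of_sum_zero_of_exists_nonzero w hw
    ⟨i, Finset.mem_univ i, hi⟩
  obtain ⟨c, -, hc⟩ : ∃ c ∈ Finset.univ, w c < 0 := by
    by_contra! hneg
    exact ha.ne' ((Finset.sum_eq_zero_iff_of_nonneg hneg).1 hw a (Finset.mem_univ a))
  obtain ⟨b, hba, hb⟩ := hside a ha.ne'
  obtain ⟨d, hdc, hd⟩ := hside c hc.ne
  replace hb : 0 < w b := pos_of_mul_pos_right hb ha.le
  replace hd : w d < 0 := neg_of_mul_pos_right hd hc.le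
  have hne {j k : Fin 4} (hj : 0 < w j) (hk : w k < 0) : j ≠ k := by
    rintro rfl
    exact hj.not_gt hk
  have huniv : ∀ a b c d : Fin 4, b ≠ a → d ≠ c → a ≠ c → a ≠ d → b ≠ c → b ≠ d →
      (Finset.univ : Finset (Fin 4)) = {a, b, c, d} := by decide
  have hsum {M : Type} [AddCommMonoid M] (g : Fin 4 → M) :
      ∑ j, g j = g a + (g b + (g c + g d)) := by
    rw [huniv a b c d hba hdc (hne ha hc) (hne ha hd) (hne hb hc) (hne hb hd),
      Finset.sum_insert (by simp [hba.symm, hne ha hc, hne ha hd]),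
      Finset.sum_insert (by simp [hne hb hc, hne hb hd]), Finset.sum_pair hdc.symm]
  have hmem : ∑ j, w j • stdVert n (idx j) ∈ L := by
    rw [← hπ, LinearMap.mem_ker, map_sum]
    simpa only [map_smul] using hf
  have hnonneg := hX.quadraticForm_nonneg (x ∘ idx) (stdVert n ∘ idx) W
    (fun j k => hW (idx j) (idx k)) w ha hb hc hd (hsum w ▸ hw)
  simp only [Function.comp_apply] at hnonneg
  rw [← hsum fun j => w j • stdVert n (idx j)] at hnonneg
  refine (hL _ hmem fun hzero => hi ?_).not_ge hnonneg
  exact affineIndependent_iff.1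
    ((stdVert_affineIndependent n).comp_embedding ⟨idx, hinj⟩) Finset.univ w hw hzero i
    (Finset.mem_univ i)
end

section
/- Let x₁,…,x₅ ∈ ℝ⁴ be five affinely independent points, K their convex hull, and Σ the boundary of K. Let v ∈ ℝ⁴ be a nonzero vector and π : ℝ⁴ → ℝ³ a surjective linear map whose kernel is spanned by v. Define Σ⁻(v) = {p ∈ Σ : p + t·v ∉ K for all t < 0} and Σ⁺(v) = {p ∈ Σ : p + t·v ∉ K for all t > 0}. If the projected array (π(x₁),…,π(x₅)) belongs to 𝒜 and satisfies m ≠ 0, then either all ten segments [xᵢ, xⱼ] (i ≠ j) are contained in Σ⁻(v), or all ten segments [xᵢ, xⱼ] (i ≠ j) are contained in Σ⁺(v). -/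
/-- Orientation sign of the `i`-th facet. -/
noncomputable def facetSign (y : Fin 5 → EuclideanSpace ℝ (Fin 3)) (i : Fin 5) : ℝ :=
  Real.sign ((-1 : ℝ) ^ ((i : ℕ) + 1) *
    Matrix.det (Matrix.of fun a b : Fin 3 =>
      (y (Fin.succAbove i b.succ) - y (Fin.succAbove i 0)) a))

def MemA (y : Fin 5 → EuclideanSpace ℝ (Fin 3)) : Prop :=
  ¬ Coplanar ℝ (Set.range y) ∧
    ∀ i j k : Fin 5, i ≠ j → j ≠ k → i ≠ k →
      ¬ Collinear ℝ ({y i, y j, y k} : Set (EuclideanSpace ℝ (Fin 3)))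

noncomputable def nPlus (y : Fin 5 → EuclideanSpace ℝ (Fin 3)) : ℕ :=
  Nat.card {i : Fin 5 // facetSign y i = 1}

noncomputable def nMinus (y : Fin 5 → EuclideanSpace ℝ (Fin 3)) : ℕ :=
  Nat.card {i : Fin 5 // facetSign y i = -1}

noncomputable def nZero (y : Fin 5 → EuclideanSpace ℝ (Fin 3)) : ℕ :=
  Nat.card {i : Fin 5 // facetSign y i = 0}

noncomputable def mVal (y : Fin 5 → EuclideanSpace ℝ (Fin 3)) : ℤ :=
  (nMinus y : ℤ) - (nPlus y : ℤ)

/-- The signed maximal minor attached to the `i`-th facet; `facetSign` is its sign. -/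
noncomputable def facetMinor (y : Fin 5 → EuclideanSpace ℝ (Fin 3)) (i : Fin 5) : ℝ :=
  (-1 : ℝ) ^ ((i : ℕ) + 1) *
    Matrix.det (Matrix.of fun a b : Fin 3 =>
      (y (Fin.succAbove i b.succ) - y (Fin.succAbove i 0)) a)

theorem sum_facetMinor (y : Fin 5 → EuclideanSpace ℝ (Fin 3)) :
    ∑ i, facetMinor y i = 0 := by
  simp [facetMinor, Fin.sum_univ_five, Matrix.det_fin_three, Fin.succAbove]
  ring

theorem sum_facetMinor_smul (y : Fin 5 → EuclideanSpace ℝ (Fin 3)) :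
    ∑ i, facetMinor y i • y i = 0 := by
  ext a
  fin_cases a <;>
  · simp [facetMinor, Fin.sum_univ_five, Matrix.det_fin_three, Fin.succAbove]
    ring

theorem Real.sign_eq_one_iff_pos {r : ℝ} : Real.sign r = 1 ↔ 0 < r := by
  rcases lt_trichotomy r 0 with h | rfl | h
  · simp only [Real.sign_of_neg h, h.not_gt, iff_false]; norm_num
  · simp
  · simp [Real.sign_of_pos h, h]

theorem Real.sign_eq_neg_one_iff_neg {r : ℝ} : Real.sign r = -1 ↔ r < 0 := by
  rw [← Left.neg_pos_iff, ← Real.sign_eq_one_iff_pos, Real.sign_neg, neg_eq_iff_eq_neg]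

theorem nPlus_eq_card (y : Fin 5 → EuclideanSpace ℝ (Fin 3)) :
    nPlus y = (Finset.univ.filter fun i => 0 < facetMinor y i).card := by
  rw [nPlus, ← Fintype.card_subtype, ← Nat.card_eq_fintype_card]
  exact Nat.card_congr (Equiv.subtypeEquivRight fun i => Real.sign_eq_one_iff_pos)

theorem nMinus_eq_card (y : Fin 5 → EuclideanSpace ℝ (Fin 3)) :
    nMinus y = (Finset.univ.filter fun i => facetMinor y i < 0).card := by
  rw [nMinus, ← Fintype.card_subtype, ← Nat.card_eq_fintype_card]
  exact Nat.card_congr (Equiv.subtypeEquivRight fun i => Real.sign_eq_neg_one_iff_neg)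

theorem exists_univ_eq_insert_of_ne : ∀ a b : Fin 5, a ≠ b → ∃ i j k : Fin 5,
    i ≠ j ∧ j ≠ k ∧ i ≠ k ∧ a ∉ ({b, i, j, k} : Finset (Fin 5)) ∧
      b ∉ ({i, j, k} : Finset (Fin 5)) ∧ Finset.univ = ({a, b, i, j, k} : Finset (Fin 5)) := by
  decide

/-- A nontrivial affine dependence among five points, no three of them collinear, has at most one
vanishing coefficient. -/
theorem eq_zero_of_two_coeffs_eq_zero {V : Type*} [AddCommGroup V] [Module ℝ V] {y : Fin 5 → V}
    (hy : ∀ i j k : Fin 5, i ≠ j → j ≠ k → i ≠ k → ¬ Collinear ℝ ({y i, y j, y k} : Set V))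
    {d : Fin 5 → ℝ} (hd : ∑ i, d i = 0) (hdy : ∑ i, d i • y i = 0) {a b : Fin 5} (hab : a ≠ b)
    (ha : d a = 0) (hb : d b = 0) : ∀ i, d i = 0 := by
  obtain ⟨i, j, k, hij, hjk, hik, ha', hb', huniv⟩ := exists_univ_eq_insert_of_ne a b hab
  have hi : i ∉ ({j, k} : Finset (Fin 5)) := by simp [hij, hik]
  rw [huniv, Finset.sum_insert ha', Finset.sum_insert hb', Finset.sum_insert hi,
    Finset.sum_pair hjk] at hd hdy
  have hind := affineIndependent_iff.1
    (affineIndependent_iff_not_collinear_set.2 (hy i j k hij hjk hik))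
    Finset.univ ![d i, d j, d k]
    (by simpa [Fin.sum_univ_three, ha, hb, add_assoc] using hd)
    (by simpa [Fin.sum_univ_three, ha, hb, add_assoc] using hdy)
  have h0 : d i = 0 := hind 0 (Finset.mem_univ _)
  have h1 : d j = 0 := hind 1 (Finset.mem_univ _)
  have h2 : d k = 0 := hind 2 (Finset.mem_univ _)
  intro l
  have hl : l ∈ ({a, b, i, j, k} : Finset (Fin 5)) := huniv ▸ Finset.mem_univ l
  simp only [Finset.mem_insert, Finset.mem_singleton] at hl
  rcases hl with rfl | rfl | rfl | rfl | rfl <;> assumption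

theorem exists_mem_ne_ne_of_three_le_card {α : Type*} [DecidableEq α] {s : Finset α}
    (hs : 3 ≤ s.card) (i j : α) : ∃ k ∈ s, k ≠ i ∧ k ≠ j := by
  have hlt : ({i, j} : Finset α).card < s.card := Finset.card_le_two.trans_lt hs
  obtain ⟨k, hk, hkn⟩ := Finset.exists_mem_notMem_of_card_lt_card hlt
  exact ⟨k, hk, by simpa using hkn⟩

theorem exists_weights_of_mem_convexHull_range {ι V : Type*} [Fintype ι] [AddCommGroup V]
    [Module ℝ V] {x : ι → V} {p : V} (hp : p ∈ convexHull ℝ (Set.range x)) :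
    ∃ w : ι → ℝ, (∀ i, 0 ≤ w i) ∧ ∑ i, w i = 1 ∧ ∑ i, w i • x i = p := by
  classical
  have himage : Set.range x =
      Fintype.linearCombination ℝ x '' Set.range fun i : ι => Pi.single i (1 : ℝ) := by
    ext q
    simp [Fintype.linearCombination_apply_single]
  rw [himage, ← LinearMap.image_convexHull, convexHull_rangle_single_eq_stdSimplex] at hp
  obtain ⟨w, ⟨hw0, hw1⟩, rfl⟩ := hp
  exact ⟨w, hw0, hw1, rfl⟩

/-- If some barycentric direction coefficient of `v` off the edge `[xᵢ, xⱼ]` is positive, then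
moving from the edge in direction `-v` leaves the simplex. -/
theorem add_smul_notMem_convexHull {ι V : Type*} [Fintype ι] [AddCommGroup V] [Module ℝ V]
    {x : ι → V} (hx : AffineIndependent ℝ x) {n : ι → ℝ} (hn : ∑ i, n i = 0)
    {i j k : ι} (hki : k ≠ i) (hkj : k ≠ j) (hk : 0 < n k) {p : V}
    (hp : p ∈ segment ℝ (x i) (x j)) {t : ℝ} (ht : t < 0) :
    p + t • ∑ l, n l • x l ∉ convexHull ℝ (Set.range x) := by
  classical
  intro hmem
  obtain ⟨w, hw0, hw1, hw⟩ := exists_weights_of_mem_convexHull_range hmem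
  obtain ⟨a, b, -, -, hab, rfl⟩ := hp
  have hzero := affineIndependent_iff.1 hx Finset.univ
    (fun l => w l - ((Pi.single i a : ι → ℝ) l + (Pi.single j b : ι → ℝ) l) - t * n l)
    (by simp [Finset.sum_sub_distrib, Finset.sum_add_distrib, ← Finset.mul_sum, hw1, hn, hab])
    (by
      have hi : ∑ l, (Pi.single i a : ι → ℝ) l • x l = a • x i := by
        simp [Pi.single_apply, ite_smul]
      have hj : ∑ l, (Pi.single j b : ι → ℝ) l • x l = b • x j := by
        simp [Pi.single_apply, ite_smul]
      simp only [sub_smul, add_smul, mul_smul, Finset.sum_sub_distrib, Finset.sum_add_distrib,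
        ← Finset.smul_sum, hi, hj, hw]
      abel)
    k (Finset.mem_univ k)
  simp only [Pi.single_eq_of_ne hki, Pi.single_eq_of_ne hkj] at hzero
  have := hw0 k
  nlinarith

theorem notMem_interior_of_add_smul_notMem {V : Type*} [NormedAddCommGroup V] [NormedSpace ℝ V]
    {K : Set V} {p v : V} (h : ∀ t : ℝ, t < 0 → p + t • v ∉ K) : p ∉ interior K := by
  intro hp
  have hcont : Filter.Tendsto (fun t : ℝ => p + t • v) (nhdsWithin 0 (Set.Iio 0)) (nhds p) := by
    have : Continuous fun t : ℝ => p + t • v := by fun_prop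
    simpa using (this.tendsto 0).mono_left nhdsWithin_le_nhds
  have hev := hcont.eventually (mem_interior_iff_mem_nhds.1 hp)
  obtain ⟨t, htK, ht⟩ := (hev.and self_mem_nhdsWithin).exists
  exact h t ht htK

theorem edges_subset_lower_side {x : Fin 5 → EuclideanSpace ℝ (Fin 4)}
    (hx : AffineIndependent ℝ x) {n : Fin 5 → ℝ} (hn : ∑ i, n i = 0)
    (hpos : 3 ≤ (Finset.univ.filter fun i => 0 < n i).card) (i j : Fin 5)
    {p : EuclideanSpace ℝ (Fin 4)} (hp : p ∈ segment ℝ (x i) (x j)) :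
    p ∈ frontier (convexHull ℝ (Set.range x)) ∧
      ∀ t : ℝ, t < 0 → p + t • ∑ l, n l • x l ∉ convexHull ℝ (Set.range x) := by
  obtain ⟨k, hk, hki, hkj⟩ := exists_mem_ne_ne_of_three_le_card hpos i j
  have hout : ∀ t : ℝ, t < 0 → p + t • ∑ l, n l • x l ∉ convexHull ℝ (Set.range x) :=
    fun t ht => add_smul_notMem_convexHull hx hn hki hkj (Finset.mem_filter.1 hk).2 hp ht
  refine ⟨⟨subset_closure ?_, notMem_interior_of_add_smul_notMem hout⟩, hout⟩
  exact segment_subset_convexHull (Set.mem_range_self i) (Set.mem_range_self j) hp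

theorem edges_on_one_side_of_three_le {x : Fin 5 → EuclideanSpace ℝ (Fin 4)}
    (hx : AffineIndependent ℝ x) {n : Fin 5 → ℝ} (hn : ∑ i, n i = 0)
    (hcard : 3 ≤ (Finset.univ.filter fun i => 0 < n i).card ∨
      3 ≤ (Finset.univ.filter fun i => n i < 0).card) :
    (∀ i j : Fin 5, i ≠ j → ∀ p ∈ segment ℝ (x i) (x j),
        p ∈ frontier (convexHull ℝ (Set.range x)) ∧
          ∀ t : ℝ, t < 0 → p + t • ∑ l, n l • x l ∉ convexHull ℝ (Set.range x)) ∨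
      (∀ i j : Fin 5, i ≠ j → ∀ p ∈ segment ℝ (x i) (x j),
        p ∈ frontier (convexHull ℝ (Set.range x)) ∧
          ∀ t : ℝ, t > 0 → p + t • ∑ l, n l • x l ∉ convexHull ℝ (Set.range x)) := by
  refine hcard.imp (fun h i j _ p hp => edges_subset_lower_side hx hn h i j hp)
    fun h i j _ p hp => ?_
  obtain ⟨hfr, hout⟩ := edges_subset_lower_side hx (n := fun l => -n l) (by simp [hn])
    (by simpa using h) i j hp
  exact ⟨hfr, fun t ht => by simpa using hout (-t) (neg_neg_of_pos ht)⟩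

theorem three_le_card_pos_or_neg {d : Fin 5 → ℝ} (hzero : ∀ a b, a ≠ b → d a = 0 → d b ≠ 0)
    (hne : (Finset.univ.filter fun i => d i < 0).card ≠
      (Finset.univ.filter fun i => 0 < d i).card) :
    3 ≤ (Finset.univ.filter fun i => 0 < d i).card ∨
      3 ≤ (Finset.univ.filter fun i => d i < 0).card := by
  have hz : (Finset.univ.filter fun i => d i = 0).card ≤ 1 := by
    refine Finset.card_le_one.2 fun a ha b hb => ?_
    simp only [Finset.mem_filter, Finset.mem_univ, true_and] at ha hb
    by_contra hab
    exact hzero a b hab ha hb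
  have hcover : (Finset.univ : Finset (Fin 5)) ⊆ (Finset.univ.filter fun i => 0 < d i) ∪
      ((Finset.univ.filter fun i => d i < 0) ∪ Finset.univ.filter fun i => d i = 0) := by
    intro i _
    simp only [Finset.mem_union, Finset.mem_filter, Finset.mem_univ, true_and]
    rcases lt_trichotomy (d i) 0 with h | h | h <;> simp [h]
  have h5 := Finset.card_le_card hcover
  rw [Finset.card_univ, Fintype.card_fin] at h5
  have h1 := Finset.card_union_le (Finset.univ.filter fun i => 0 < d i)
    ((Finset.univ.filter fun i => d i < 0) ∪ Finset.univ.filter fun i => d i = 0)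
  have h2 := Finset.card_union_le (Finset.univ.filter fun i => d i < 0)
    (Finset.univ.filter fun i => d i = 0)
  omega

/-- Let `x₁,…,x₅ ∈ ℝ⁴` be affinely independent, `K` their convex hull with boundary
`Σ`, `v ≠ 0`, and `π : ℝ⁴ → ℝ³` a surjective linear map with kernel spanned by
`v`.  If the projected array lies in `𝒜` with `m ≠ 0`, then either all ten edges
`[xᵢ, xⱼ]` lie in the lower side `Σ⁻(v)` of `Σ` with respect to `v`, or all ten
edges lie in the upper side `Σ⁺(v)`. -/
theorem edges_on_one_side (x : Fin 5 → EuclideanSpace ℝ (Fin 4))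
    (hx : AffineIndependent ℝ x)
    (K : Set (EuclideanSpace ℝ (Fin 4))) (hK : K = convexHull ℝ (Set.range x))
    (v : EuclideanSpace ℝ (Fin 4)) (hv : v ≠ 0)
    (π : EuclideanSpace ℝ (Fin 4) →ₗ[ℝ] EuclideanSpace ℝ (Fin 3))
    (hsurj : Function.Surjective π)
    (hker : LinearMap.ker π = Submodule.span ℝ {v})
    (hA : MemA (fun i => π (x i)))
    (hm : mVal (fun i => π (x i)) ≠ 0) :
    (∀ i j : Fin 5, i ≠ j → ∀ p ∈ segment ℝ (x i) (x j),
        p ∈ frontier K ∧ ∀ t : ℝ, t < 0 → p + t • v ∉ K) ∨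
      (∀ i j : Fin 5, i ≠ j → ∀ p ∈ segment ℝ (x i) (x j),
        p ∈ frontier K ∧ ∀ t : ℝ, t > 0 → p + t • v ∉ K) := by
  subst hK
  set d := facetMinor fun i => π (x i) with hd_def
  have hd : ∑ i, d i = 0 := sum_facetMinor _
  have hdy : ∑ i, d i • π (x i) = 0 := sum_facetMinor_smul _
  have hne : (Finset.univ.filter fun i => d i < 0).card ≠
      (Finset.univ.filter fun i => 0 < d i).card := by
    intro h
    exact hm (by rw [mVal, nMinus_eq_card, nPlus_eq_card, h, sub_self])
  have hnontriv : ¬ ∀ i, d i = 0 := fun h => hne (by simp [h])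
  have hcard := three_le_card_pos_or_neg
    (fun a b hab ha hb => hnontriv (eq_zero_of_two_coeffs_eq_zero hA.2 hd hdy hab ha hb)) hne
  have hmem : ∑ i, d i • x i ∈ Submodule.span ℝ {v} := by
    rw [← hker, LinearMap.mem_ker]
    simpa using hdy
  obtain ⟨c, hc⟩ := Submodule.mem_span_singleton.1 hmem
  have hc0 : c ≠ 0 := by
    rintro rfl
    rw [zero_smul] at hc
    exact hnontriv fun i => affineIndependent_iff.1 hx Finset.univ d hd hc.symm i
      (Finset.mem_univ i)
  have hvn : v = ∑ i, (c⁻¹ * d i) • x i := by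
    simp only [mul_smul, ← Finset.smul_sum, ← hc]
    rw [inv_smul_smul₀ hc0]
  rw [hvn]
  refine edges_on_one_side_of_three_le hx (by rw [← Finset.mul_sum, hd, mul_zero]) ?_
  rcases lt_or_gt_of_ne (inv_ne_zero hc0) with hneg | hpos
  · simpa only [mul_pos_iff, mul_neg_iff, hneg, hneg.not_gt, true_and, false_and, false_or]
      using hcard.symm
  · simpa only [mul_pos_iff, mul_neg_iff, hpos, hpos.not_gt, true_and, false_and, or_false]
      using hcard
end
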